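/- Let (G,w) be an energy game with n = |V| and W = max_{(u,v) ∈ E} |w(u,v)|, let s be a node of G, and let (G',w') be the gadget graph obtained from (G,w) and s by replacing every edge by a five-edge construction as described. Then one player wins at every node of (G',w'): if Alice wins at s in (G,w), then Alice wins at every node of (G',w'), and if Bob wins at s in (G,w), then Bob wins at every node of (G',w'). -/

import Mathlib

/-!
Common definitions for energy games (Brim et al. style), following the paper's
definitions: a game graph is a finite directed graph in which every node has
out-degree at least one, together with a partition of the nodes into Alice's
nodes `VA` and Bob's nodes (the complement of `VA`).  Strategies are positional.
For a fixed pair of strategies the play from a node `s` is the orbit of the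
induced successor function, and the minimal sufficient energy at `s` is the
least initial energy that keeps the running energy nonnegative forever, i.e.
`⨆ i, (-(weight of the length-i prefix))⁺ ∈ ℕ∞`; this coincides with
`∞` when the reachable cycle is negative and with `max (0, -min_P w(P))`
(minimum over simple paths `P` from `s`) otherwise.
-/

open scoped BigOperators

universe u

structure GameGraph (V : Type u) [Fintype V] [DecidableEq V] where
  E : Finset (V × V)
  VA : Finset V
  exists_succ : ∀ v : V, ∃ u : V, (v, u) ∈ E

namespace GameGraph

variable {V : Type u} [Fintype V] [DecidableEq V]

/-- Positional strategies of Alice: a choice of an out-edge at every node of Alice. -/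
def AliceStrategy (G : GameGraph V) : Type u :=
  {σ : V → V // ∀ u ∈ G.VA, (u, σ u) ∈ G.E}

/-- Positional strategies of Bob: a choice of an out-edge at every node of Bob. -/
def BobStrategy (G : GameGraph V) : Type u :=
  {τ : V → V // ∀ u : V, u ∉ G.VA → (u, τ u) ∈ G.E}

/-- The successor function of `G(σ,τ)`, the graph in which every node keeps only the
out-edge chosen by its owner's strategy. -/
def play (G : GameGraph V) (σ : G.AliceStrategy) (τ : G.BobStrategy) (v : V) : V :=
  if v ∈ G.VA then σ.1 v else τ.1 v

/-- Total weight of the length-`i` prefix of the unique path from `s` in the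
functional graph with successor function `f`. -/
def prefixWeight (w : V → V → ℤ) (f : V → V) (s : V) (i : ℕ) : ℤ :=
  ∑ j ∈ Finset.range i, w (f^[j] s) (f^[j + 1] s)

/-- The minimal sufficient energy `e*_{G(σ,τ),w}(s)` at `s` for a fixed pair of
strategies with induced successor function `f`:  the least initial energy
(in `ℕ∞ = ℤ≥0 ∪ {∞}`) keeping the running energy nonnegative forever.  It is `∞`
iff the unique cycle reachable from `s` is negative, and `max (0, -min_P w(P))`
(minimum over simple paths from `s`) otherwise. -/
noncomputable def stratEnergy (w : V → V → ℤ) (f : V → V) (s : V) : ℕ∞ :=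
  ⨆ i : ℕ, ((-(prefixWeight w f s i)).toNat : ℕ∞)

/-- The minimal sufficient energy `e*_{G,w}(s) = min_σ max_τ e*_{G(σ,τ),w}(s)`. -/
noncomputable def minEnergy (G : GameGraph V) (w : V → V → ℤ) (s : V) : ℕ∞ :=
  ⨅ σ : G.AliceStrategy, ⨆ τ : G.BobStrategy, stratEnergy w (G.play σ τ) s

/-- Alice wins at `s` iff the minimal sufficient energy at `s` is finite. -/
noncomputable def AliceWins (G : GameGraph V) (w : V → V → ℤ) (s : V) : Prop :=
  G.minEnergy w s ≠ ⊤

/-- The canonical embedding `ℕ∞ = ℤ≥0 ∪ {∞} → ℤ ∪ {∞}` (extended arithmetic: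
`∞ + x = ∞`, `∞ ≥ x`). -/
def toZInf (x : ℕ∞) : WithTop ℤ :=
  if x = ⊤ then ⊤ else ((x.toNat : ℤ) : WithTop ℤ)

/-- `max (x - z, 0)` for `x : ℕ∞` and `z : ℤ`, with `∞ - z = ∞`. -/
def esub (x : ℕ∞) (z : ℤ) : ℕ∞ :=
  if x = ⊤ then ⊤ else ((((x.toNat : ℤ) - z).toNat : ℕ) : ℕ∞)

/-- The successors of `u` in `G`. -/
def succs (G : GameGraph V) (u : V) : Finset V :=
  (G.E.filter (fun p => p.1 = u)).image Prod.snd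

/-- The weight function with every weight rounded up to the nearest multiple of `B`:
`w_B(u,v) = ⌈w(u,v)/B⌉·B`. -/
def roundW (w : V → V → ℤ) (B : ℤ) : V → V → ℤ :=
  fun u v => ⌈(w u v : ℚ) / (B : ℚ)⌉ * B

/-- `W = max_{(u,v) ∈ E} |w(u,v)|`. -/
def maxAbsW (G : GameGraph V) (w : V → V → ℤ) : ℕ :=
  G.E.sup (fun p => (w p.1 p.2).natAbs)

/-- A strategy `τ` of Bob is optimal if `e*_{G(σ,τ),w}(s) ≥ e*_{G,w}(s)` for every
node `s` and every strategy `σ` of Alice. -/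
noncomputable def IsOptimalBob (G : GameGraph V) (w : V → V → ℤ) (τ : G.BobStrategy) : Prop :=
  ∀ (s : V) (σ : G.AliceStrategy), G.minEnergy w s ≤ stratEnergy w (G.play σ τ) s

/-- Total weight of the cycle of length `L` through `x` in the functional graph `f`. -/
def cycleWeight (w : V → V → ℤ) (f : V → V) (x : V) (L : ℕ) : ℤ :=
  ∑ j ∈ Finset.range L, w (f^[j] x) (f^[j + 1] x)

/-- A node `s` has penalty at least `D ≥ 0` if there is an optimal strategy `τ*` of Bob
such that for every strategy `σ` of Alice the unique cycle `C` reachable from `s` in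
`G(σ,τ*)` satisfies: if `w(C) < 0` then the average weight `w(C)/|C|` is at most `-D`.
(The cycle is described by any node `x` on it, reachable from `s`, together with its
minimal period `L`.) -/
noncomputable def HasPenaltyAtLeast (G : GameGraph V) (w : V → V → ℤ) (s : V) (D : ℝ) : Prop :=
  ∃ τ : G.BobStrategy, G.IsOptimalBob w τ ∧
    ∀ σ : G.AliceStrategy, ∀ x : V, (∃ i : ℕ, (G.play σ τ)^[i] s = x) →
      ∀ L : ℕ, 0 < L → (G.play σ τ)^[L] x = x →
        (∀ k : ℕ, 0 < k → k < L → (G.play σ τ)^[k] x ≠ x) →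
        cycleWeight w (G.play σ τ) x L < 0 →
        ((cycleWeight w (G.play σ τ) x L : ℝ) / (L : ℝ) ≤ -D)

end GameGraph

namespace GameGraph

variable {V : Type u} [Fintype V] [DecidableEq V]

/-- The edges of `G`, as a type. -/
abbrev EdgeSub (G : GameGraph V) : Type u := {p : V × V // p ∈ G.E}

/-- The node type of the gadget graph: the original nodes, plus for every edge
`e = (x,y)` of `G` a new Alice node `u_e` (left) and a new Bob node `v_e` (right). -/
abbrev GadgetV (G : GameGraph V) : Type u := V ⊕ (EdgeSub G ⊕ EdgeSub G)

/-- Edges of the gadget graph: every edge `e = (x,y)` of `G` is replaced by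
`(x, u_e)`, `(u_e, v_e)`, `(v_e, y)`, and the two back edges `(u_e, s)`, `(v_e, s)`. -/
def gadgetEdge (G : GameGraph V) (s : V) : GadgetV G × GadgetV G → Bool
  | (Sum.inl x, Sum.inr (Sum.inl e)) => decide (e.1.1 = x)
  | (Sum.inr (Sum.inl e), Sum.inr (Sum.inr e')) => decide (e = e')
  | (Sum.inr (Sum.inl _), Sum.inl y) => decide (y = s)
  | (Sum.inr (Sum.inr e), Sum.inl y) => decide (e.1.2 = y ∨ y = s)
  | _ => false

/-- The gadget game graph `G'` obtained from `(G, w)` and the designated node `s`. -/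
def gadget (G : GameGraph V) (s : V) : GameGraph (GadgetV G) where
  E := Finset.univ.filter (fun q => gadgetEdge G s q = true)
  VA := Finset.univ.filter (fun a : GadgetV G =>
    (match a with
      | Sum.inl x => decide (x ∈ G.VA)
      | Sum.inr (Sum.inl _) => true
      | Sum.inr (Sum.inr _) => false) = true)
  exists_succ := by
    rintro (x | e | e)
    · obtain ⟨y, hy⟩ := G.exists_succ x
      exact ⟨Sum.inr (Sum.inl ⟨(x, y), hy⟩), by
        simp [gadgetEdge]⟩
    · exact ⟨Sum.inr (Sum.inr e), by simp [gadgetEdge]⟩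
    · exact ⟨Sum.inl e.1.2, by simp [gadgetEdge]⟩

/-- The weights of the gadget graph: `w'(x, u_e) = w(x,y)` for `e = (x,y)`,
`w'(u_e, v_e) = 0`, `w'(v_e, y) = 0`, `w'(u_e, s) = -nW` and `w'(v_e, s) = nW`,
where `n = |V|` and `W = max_{(u,v) ∈ E} |w(u,v)|`. -/
def gadgetW (G : GameGraph V) (w : V → V → ℤ) (s : V) :
    GadgetV G → GadgetV G → ℤ := fun a b =>
  match a, b with
  | Sum.inl _, Sum.inr (Sum.inl e) => w e.1.1 e.1.2
  | Sum.inr (Sum.inl _), Sum.inl _ =>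
      -((Fintype.card V : ℤ) * (G.maxAbsW w : ℤ))
  | Sum.inr (Sum.inr e), Sum.inl y =>
      if y = e.1.2 then 0 else (Fintype.card V : ℤ) * (G.maxAbsW w : ℤ)
  | _, _ => 0

end GameGraph

namespace GameGraph

variable {V : Type u} [Fintype V] [DecidableEq V]

theorem prefixWeight_add (w : V → V → ℤ) (f : V → V) (s : V) (i j : ℕ) :
    prefixWeight w f s (i + j) = prefixWeight w f s i + prefixWeight w f (f^[i] s) j := by
  unfold prefixWeight
  rw [Finset.sum_range_add]
  congr 1
  refine Finset.sum_congr rfl fun k _ => ?_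
  rw [← Function.iterate_add_apply, ← Function.iterate_add_apply]
  rw [add_comm k i, show k + 1 + i = i + k + 1 by omega]

theorem prefixWeight_one (w : V → V → ℤ) (f : V → V) (s : V) :
    prefixWeight w f s 1 = w s (f s) := by
  simp [prefixWeight]

theorem prefixWeight_congr (w : V → V → ℤ) {f g : V → V} {s : V}
    (h : ∀ i, f^[i] s = g^[i] s) (i : ℕ) : prefixWeight w f s i = prefixWeight w g s i := by
  simp only [prefixWeight, h]

theorem stratEnergy_ne_top_iff (w : V → V → ℤ) (f : V → V) (s : V) :
    stratEnergy w f s ≠ ⊤ ↔ ∃ C : ℕ, ∀ i, -(C : ℤ) ≤ prefixWeight w f s i := by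
  unfold stratEnergy
  rw [← lt_top_iff_ne_top, ENat.iSup_natCast_lt_top]
  constructor
  · rintro ⟨C, hC⟩
    refine ⟨C, fun i => ?_⟩
    have := hC ⟨i, rfl⟩
    simp only at this
    omega
  · rintro ⟨C, hC⟩
    refine ⟨C, ?_⟩
    rintro _ ⟨i, rfl⟩
    have := hC i
    simp only
    omega

theorem stratEnergy_congr (w : V → V → ℤ) {f g : V → V} {s : V}
    (h : ∀ i, f^[i] s = g^[i] s) : stratEnergy w f s = stratEnergy w g s := by
  simp only [stratEnergy, prefixWeight_congr w h]

theorem stratEnergy_apply_ne_top_iff (w : V → V → ℤ) (f : V → V) (s : V) :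
    stratEnergy w f (f s) ≠ ⊤ ↔ stratEnergy w f s ≠ ⊤ := by
  simp only [stratEnergy_ne_top_iff]
  have key : ∀ i, prefixWeight w f s (1 + i) = w s (f s) + prefixWeight w f (f s) i := fun i => by
    rw [prefixWeight_add, prefixWeight_one]; rfl
  constructor
  · rintro ⟨C, hC⟩
    refine ⟨C + (w s (f s)).natAbs, fun i => ?_⟩
    rcases i with _ | i
    · simp only [prefixWeight, Finset.range_zero, Finset.sum_empty]; omega
    · rw [add_comm i 1, key]
      have := hC i
      omega
  · rintro ⟨C, hC⟩
    refine ⟨C + (w s (f s)).natAbs, fun i => ?_⟩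
    have := hC (1 + i)
    rw [key] at this
    omega

theorem stratEnergy_iterate_ne_top_iff (w : V → V → ℤ) (f : V → V) (s : V) (i : ℕ) :
    stratEnergy w f (f^[i] s) ≠ ⊤ ↔ stratEnergy w f s ≠ ⊤ := by
  induction i with
  | zero => rfl
  | succ i ih => rw [Function.iterate_succ_apply', stratEnergy_apply_ne_top_iff, ih]

theorem prefixWeight_mul_of_periodic (w : V → V → ℤ) {f : V → V} {s : V} {L : ℕ}
    (hL : f^[L] s = s) (m : ℕ) : prefixWeight w f s (L * m) = m * prefixWeight w f s L := by
  induction m with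
  | zero => simp [prefixWeight]
  | succ m ih =>
    have hm : f^[L * m] s = s := by
      rw [Function.iterate_mul]; exact Function.iterate_fixed hL m
    rw [Nat.mul_succ, prefixWeight_add, hm, ih]
    push_cast
    ring

/-- A finite minimal energy on a periodic play means that the period is nonnegative. -/
theorem prefixWeight_nonneg_of_stratEnergy_ne_top {w : V → V → ℤ} {f : V → V} {s : V} {L : ℕ}
    (hL : f^[L] s = s) (h : stratEnergy w f s ≠ ⊤) : 0 ≤ prefixWeight w f s L := by
  obtain ⟨C, hC⟩ := (stratEnergy_ne_top_iff w f s).1 h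
  by_contra! hneg
  have := hC (L * (C + 1))
  rw [prefixWeight_mul_of_periodic w hL] at this
  push_cast at this
  nlinarith

theorem stratEnergy_ne_top_of_periodic {w : V → V → ℤ} {f : V → V} {s : V} {L : ℕ}
    (hpos : 0 < L) (hL : f^[L] s = s) (h : 0 ≤ prefixWeight w f s L) :
    stratEnergy w f s ≠ ⊤ := by
  rw [stratEnergy_ne_top_iff]
  refine ⟨∑ r ∈ Finset.range L, (prefixWeight w f s r).natAbs, fun i => ?_⟩
  have hm : f^[L * (i / L)] s = s := by
    rw [Function.iterate_mul]; exact Function.iterate_fixed hL _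
  have hle : (prefixWeight w f s (i % L)).natAbs ≤
      ∑ r ∈ Finset.range L, (prefixWeight w f s r).natAbs :=
    Finset.single_le_sum (f := fun r => (prefixWeight w f s r).natAbs)
      (fun _ _ => Nat.zero_le _) (Finset.mem_range.2 (Nat.mod_lt i hpos))
  have hnn : 0 ≤ ((i / L : ℕ) : ℤ) * prefixWeight w f s L := by positivity
  have hadd := prefixWeight_add w f s (L * (i / L)) (i % L)
  rw [Nat.div_add_mod, hm, prefixWeight_mul_of_periodic w hL] at hadd
  omega

theorem exists_lt_iterate_eq (f : V → V) (s : V) :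
    ∃ a b, a < b ∧ b ≤ Fintype.card V ∧ f^[a] s = f^[b] s := by
  obtain ⟨a, b, hab, h⟩ := Fintype.exists_ne_map_eq_of_card_lt
    (fun i : Fin (Fintype.card V + 1) => f^[i.1] s) (by simp)
  rcases lt_or_gt_of_ne hab with hlt | hlt
  · exact ⟨a, b, hlt, Nat.lt_succ_iff.1 b.2, h⟩
  · exact ⟨b, a, hlt, Nat.lt_succ_iff.1 a.2, h.symm⟩

theorem exists_iterate_eq_of_lt_card (f : V → V) (s : V) (i : ℕ) :
    ∃ j < Fintype.card V, f^[j] s = f^[i] s := by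
  induction i using Nat.strong_induction_on with
  | _ i ih =>
    by_cases hi : i < Fintype.card V
    · exact ⟨i, hi, rfl⟩
    · obtain ⟨a, b, hab, hb, h⟩ := exists_lt_iterate_eq f s
      obtain ⟨j, hj, hji⟩ := ih (i - b + a) (by omega)
      refine ⟨j, hj, ?_⟩
      rw [hji, Function.iterate_add_apply, h, ← Function.iterate_add_apply]
      congr 2
      omega

theorem aliceWins_iff (G : GameGraph V) (w : V → V → ℤ) (s : V) :
    G.AliceWins w s ↔
      ∃ σ : G.AliceStrategy, ∀ τ : G.BobStrategy, stratEnergy w (G.play σ τ) s ≠ ⊤ := by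
  have : Finite G.BobStrategy := by unfold BobStrategy; infer_instance
  have : Nonempty G.BobStrategy :=
    ⟨⟨fun v => (G.exists_succ v).choose, fun v _ => (G.exists_succ v).choose_spec⟩⟩
  unfold AliceWins minEnergy
  constructor
  · intro h
    simp only [ne_eq, iInf_eq_top, not_forall] at h
    obtain ⟨σ, hσ⟩ := h
    refine ⟨σ, fun τ hτ => hσ (top_le_iff.1 ?_)⟩
    rw [← hτ]
    exact le_iSup (fun τ => stratEnergy w (G.play σ τ) s) τ
  · rintro ⟨σ, hσ⟩ h
    obtain ⟨τ, hτ⟩ := exists_eq_ciSup_of_finite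
      (f := fun τ : G.BobStrategy => stratEnergy w (G.play σ τ) s)
    exact hσ τ (hτ.trans (iInf_eq_top.1 h σ))

theorem play_mem (G : GameGraph V) (σ : G.AliceStrategy) (τ : G.BobStrategy) (v : V) :
    (v, G.play σ τ v) ∈ G.E := by
  unfold play
  split_ifs with h
  · exact σ.2 v h
  · exact τ.2 v h

theorem natAbs_le_maxAbsW (G : GameGraph V) (w : V → V → ℤ) {x y : V} (h : (x, y) ∈ G.E) :
    (w x y).natAbs ≤ G.maxAbsW w :=
  Finset.le_sup (f := fun p : V × V => (w p.1 p.2).natAbs) h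

theorem iterate_eq_of_eqOn_orbit {α : Type*} {f g : α → α} {s : α}
    (h : ∀ i, g (f^[i] s) = f (f^[i] s)) (i : ℕ) : f^[i] s = g^[i] s := by
  induction i with
  | zero => rfl
  | succ i ih => rw [Function.iterate_succ_apply', Function.iterate_succ_apply', ← ih, h]

/-- The nodes from which `σ` wins against every strategy of Bob are closed under the moves
that are consistent with `σ`. -/
theorem stratEnergy_ne_top_of_consistent {G : GameGraph V} {w : V → V → ℤ}
    {σ : G.AliceStrategy} {x y : V} (hxy : (x, y) ∈ G.E) (hσ : x ∈ G.VA → y = σ.1 x)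
    (hx : ∀ τ, stratEnergy w (G.play σ τ) x ≠ ⊤) (τ : G.BobStrategy) :
    stratEnergy w (G.play σ τ) y ≠ ⊤ := by
  by_cases hmeet : ∃ i, (G.play σ τ)^[i] y = x
  · obtain ⟨i, hi⟩ := hmeet
    rw [← stratEnergy_iterate_ne_top_iff w _ y i, hi]
    exact hx τ
  · push Not at hmeet
    let τ' : G.BobStrategy := ⟨Function.update τ.1 x y, fun u hu => by
      by_cases hux : u = x
      · subst hux; simpa using hxy
      · simpa [hux] using τ.2 u hu⟩
    have hxy' : G.play σ τ' x = y := by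
      unfold play
      split_ifs with h
      · exact (hσ h).symm
      · simp [τ']
    have hne : ∀ u, u ≠ x → G.play σ τ' u = G.play σ τ u := fun u hu => by
      simp [play, τ', hu]
    rw [stratEnergy_congr w (iterate_eq_of_eqOn_orbit fun i => hne _ (hmeet i)), ← hxy',
      stratEnergy_apply_ne_top_iff]
    exact hx τ'

/-- If `p` steps of `g` simulate every one of the first `k` steps of `f`, then the
corresponding prefixes have the same weight. -/
theorem prefixWeight_simulation {V' : Type*} [Fintype V'] [DecidableEq V']
    {w : V → V → ℤ} {w' : V' → V' → ℤ} {f : V → V} {g : V' → V'} (ι : V → V') (p : ℕ) {s : V}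
    {k : ℕ} (h : ∀ i < k, g^[p] (ι (f^[i] s)) = ι (f (f^[i] s)) ∧
      prefixWeight w' g (ι (f^[i] s)) p = w (f^[i] s) (f (f^[i] s))) :
    g^[p * k] (ι s) = ι (f^[k] s) ∧
      prefixWeight w' g (ι s) (p * k) = prefixWeight w f s k := by
  induction k with
  | zero => simp [prefixWeight]
  | succ k ih =>
    obtain ⟨h₁, h₂⟩ := ih fun i hi => h i (by omega)
    obtain ⟨h₃, h₄⟩ := h k (by omega)
    constructor
    · rw [Nat.mul_succ, add_comm, Function.iterate_add_apply, h₁, h₃,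
        Function.iterate_succ_apply']
    · rw [Nat.mul_succ, prefixWeight_add, h₁, h₂, h₄, prefixWeight_add w f s k 1,
        prefixWeight_one]

section Gadget

variable {G : GameGraph V} {w : V → V → ℤ} {s : V}

theorem mem_gadget_E {a b : GadgetV G} :
    (a, b) ∈ (gadget G s).E ↔ gadgetEdge G s (a, b) = true :=
  Finset.mem_filter_univ _

theorem mem_gadget_E_inl {x : V} {b : GadgetV G} :
    (Sum.inl x, b) ∈ (gadget G s).E ↔
      ∃ (y : V) (h : (x, y) ∈ G.E), b = Sum.inr (Sum.inl ⟨(x, y), h⟩) := by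
  rw [mem_gadget_E]
  rcases b with y | ⟨⟨x', y⟩, h⟩ | e
  · simp [gadgetEdge]
  · simp only [gadgetEdge, decide_eq_true_eq]
    constructor
    · rintro rfl
      exact ⟨y, h, rfl⟩
    · rintro ⟨y', h', he⟩
      simp only [Sum.inr.injEq, Sum.inl.injEq, Subtype.mk.injEq, Prod.mk.injEq] at he
      exact he.1
  · simp [gadgetEdge]

theorem mem_gadget_E_left {e : EdgeSub G} {b : GadgetV G} :
    (Sum.inr (Sum.inl e), b) ∈ (gadget G s).E ↔
      b = Sum.inr (Sum.inr e) ∨ b = Sum.inl s := by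
  rw [mem_gadget_E]
  rcases b with y | e' | e' <;> simp [gadgetEdge, eq_comm]

theorem mem_gadget_E_right {e : EdgeSub G} {b : GadgetV G} :
    (Sum.inr (Sum.inr e), b) ∈ (gadget G s).E ↔ b = Sum.inl e.1.2 ∨ b = Sum.inl s := by
  rw [mem_gadget_E]
  rcases b with y | e' | e'
  · simp [gadgetEdge, eq_comm (a := y) (b := e.1.2)]
  · simp [gadgetEdge]
  · simp [gadgetEdge]

theorem inl_mem_gadget_VA {x : V} :
    (Sum.inl x : GadgetV G) ∈ (gadget G s).VA ↔ x ∈ G.VA := by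
  simp [gadget]

theorem left_mem_gadget_VA (e : EdgeSub G) :
    (Sum.inr (Sum.inl e) : GadgetV G) ∈ (gadget G s).VA := by
  simp [gadget]

theorem right_notMem_gadget_VA (e : EdgeSub G) :
    (Sum.inr (Sum.inr e) : GadgetV G) ∉ (gadget G s).VA := by
  simp [gadget]

theorem abs_prefixWeight_le {f : V → V} (hf : ∀ x, (x, f x) ∈ G.E) (x : V) (k : ℕ) :
    |prefixWeight w f x k| ≤ k * G.maxAbsW w := by
  unfold prefixWeight
  refine (Finset.abs_sum_le_sum_abs _ _).trans ?_
  refine (Finset.sum_le_card_nsmul _ _ (G.maxAbsW w : ℤ) fun i _ => ?_).trans (by simp)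
  rw [Function.iterate_succ_apply', Int.abs_eq_natAbs]
  exact_mod_cast natAbs_le_maxAbsW G w (hf _)

/-- A play whose first `k + 1 ≤ |V|` edges have total weight at least `|V| * W` uses only
edges of nonnegative weight. -/
theorem stratEnergy_ne_top_of_heavy_prefix {f : V → V} (hf : ∀ x, (x, f x) ∈ G.E) {x : V}
    {k : ℕ} (hk : k < Fintype.card V)
    (h : (Fintype.card V : ℤ) * G.maxAbsW w ≤ prefixWeight w f x (k + 1)) :
    stratEnergy w f x ≠ ⊤ := by
  have hW : ∀ y, |w y (f y)| ≤ G.maxAbsW w := fun y => by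
    rw [Int.abs_eq_natAbs]
    exact_mod_cast natAbs_le_maxAbsW G w (hf _)
  have hlt : ∀ j < Fintype.card V, 0 ≤ w (f^[j] x) (f^[j + 1] x) := by
    intro j hj
    have hj' := hW (f^[j] x)
    rw [← Function.iterate_succ_apply' f] at hj'
    have hle := (le_abs_self _).trans (abs_prefixWeight_le (w := w) hf x (k + 1))
    rcases Nat.lt_or_ge (k + 1) (Fintype.card V) with hlt | hge
    · have h0 : (G.maxAbsW w : ℤ) = 0 := by
        have : ((k + 1 : ℕ) : ℤ) + 1 ≤ Fintype.card V := by exact_mod_cast hlt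
        nlinarith
      rw [h0] at hj'
      exact (abs_nonpos_iff.1 hj').ge
    · have hn : Fintype.card V = k + 1 := by omega
      have hterm : ∀ i ∈ Finset.range (k + 1),
          w (f^[i] x) (f^[i + 1] x) ≤ (G.maxAbsW w : ℤ) := fun i _ => by
        rw [Function.iterate_succ_apply']
        exact (le_abs_self _).trans (hW _)
      have hsum : ∑ i ∈ Finset.range (k + 1), w (f^[i] x) (f^[i + 1] x) =
          ∑ _i ∈ Finset.range (k + 1), (G.maxAbsW w : ℤ) := by
        refine le_antisymm (Finset.sum_le_sum hterm) ?_
        rw [hn] at h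
        simpa [prefixWeight] using h
      rw [(Finset.sum_eq_sum_iff_of_le hterm).1 hsum j (Finset.mem_range.2 (by omega))]
      positivity
  have hall : ∀ i, 0 ≤ w (f^[i] x) (f^[i + 1] x) := by
    intro i
    obtain ⟨j, hj, hji⟩ := exists_iterate_eq_of_lt_card f x i
    have := hlt j hj
    rwa [Function.iterate_succ_apply', hji, ← Function.iterate_succ_apply' f] at this
  rw [stratEnergy_ne_top_iff]
  exact ⟨0, fun i => by simpa [prefixWeight] using Finset.sum_nonneg fun j _ => hall j⟩

theorem aliceWins_of_aliceWins_gadget {v' : GadgetV G}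
    (h : (gadget G s).AliceWins (gadgetW G w s) v') : G.AliceWins w s := by
  classical
  obtain ⟨σ', hσ'⟩ := (aliceWins_iff _ _ _).1 h
  have hex : ∀ x, ∃ y, x ∈ G.VA →
      ∃ h : (x, y) ∈ G.E, σ'.1 (Sum.inl x) = Sum.inr (Sum.inl ⟨(x, y), h⟩) := by
    intro x
    by_cases hx : x ∈ G.VA
    · obtain ⟨y, hy⟩ := mem_gadget_E_inl.1 (σ'.2 _ (inl_mem_gadget_VA.2 hx))
      exact ⟨y, fun _ => hy⟩
    · exact ⟨x, fun h => absurd h hx⟩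
  choose σ₀ hσ₀ using hex
  refine (aliceWins_iff _ _ _).2 ⟨⟨σ₀, fun u hu => (hσ₀ u hu).1⟩, fun τ => ?_⟩
  have hf := G.play_mem ⟨σ₀, fun u hu => (hσ₀ u hu).1⟩ τ
  have hfA : ∀ x ∈ G.VA, G.play ⟨σ₀, fun u hu => (hσ₀ u hu).1⟩ τ x = σ₀ x :=
    fun x hx => if_pos hx
  generalize G.play ⟨σ₀, fun u hu => (hσ₀ u hu).1⟩ τ = f at hf hfA ⊢
  -- Bob copies `f`, and may return to `s` from the nodes `v_e` with `e ∉ S`.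
  let bob : Set (EdgeSub G) → (gadget G s).BobStrategy := fun S =>
    ⟨fun a => match a with
      | Sum.inl x => Sum.inr (Sum.inl ⟨(x, f x), hf x⟩)
      | Sum.inr (Sum.inl _) => Sum.inl s
      | Sum.inr (Sum.inr e) => if e ∈ S then Sum.inl e.1.2 else Sum.inl s, by
      rintro (x | e | e) hu
      · exact mem_gadget_E_inl.2 ⟨_, _, rfl⟩
      · exact absurd (left_mem_gadget_VA e) hu
      · refine mem_gadget_E_right.2 ?_
        dsimp only
        split_ifs <;> simp⟩
  have hinl : ∀ S x, (gadget G s).play σ' (bob S) (Sum.inl x) =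
      Sum.inr (Sum.inl ⟨(x, f x), hf x⟩) := by
    intro S x
    unfold play
    split_ifs with hx
    · obtain ⟨h₁, h₂⟩ := hσ₀ x (inl_mem_gadget_VA.1 hx)
      rw [h₂]
      simp only [hfA x (inl_mem_gadget_VA.1 hx)]
    · rfl
  have hleft : ∀ S e, (gadget G s).play σ' (bob S) (Sum.inr (Sum.inl e)) =
      σ'.1 (Sum.inr (Sum.inl e)) := fun S e => if_pos (left_mem_gadget_VA e)
  have hright : ∀ S e, (gadget G s).play σ' (bob S) (Sum.inr (Sum.inr e)) =
      if e ∈ S then Sum.inl e.1.2 else Sum.inl s := fun S e =>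
    if_neg (right_notMem_gadget_VA e)
  have hstart : stratEnergy (gadgetW G w s) ((gadget G s).play σ' (bob Set.univ))
      (Sum.inl s) ≠ ⊤ := by
    let S : Set (EdgeSub G) := {e | ∃ i,
      ((gadget G s).play σ' (bob Set.univ))^[i] (Sum.inl s) = Sum.inr (Sum.inr e)}
    have horbit : ∀ i, ((gadget G s).play σ' (bob Set.univ))^[i] (Sum.inl s) =
        ((gadget G s).play σ' (bob S))^[i] (Sum.inl s) := by
      refine iterate_eq_of_eqOn_orbit fun i => ?_
      rcases hi : ((gadget G s).play σ' (bob Set.univ))^[i] (Sum.inl s) with x | e | e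
      · rw [hinl, hinl]
      · rw [hleft, hleft]
      · rw [hright, hright, if_pos (Set.mem_univ e), if_pos (show e ∈ S from ⟨i, hi⟩)]
    rw [stratEnergy_congr _ horbit]
    have goR : ∀ e, stratEnergy (gadgetW G w s) ((gadget G s).play σ' (bob S))
        (Sum.inr (Sum.inr e)) ≠ ⊤ → stratEnergy (gadgetW G w s)
          ((gadget G s).play σ' (bob S)) (Sum.inl s) ≠ ⊤ := by
      intro e he
      by_cases heS : e ∈ S
      · obtain ⟨i, hi⟩ := heS
        rwa [← hi, horbit, stratEnergy_iterate_ne_top_iff] at he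
      · rwa [← stratEnergy_apply_ne_top_iff, hright, if_neg heS] at he
    have goL : ∀ e, stratEnergy (gadgetW G w s) ((gadget G s).play σ' (bob S))
        (Sum.inr (Sum.inl e)) ≠ ⊤ → stratEnergy (gadgetW G w s)
          ((gadget G s).play σ' (bob S)) (Sum.inl s) ≠ ⊤ := by
      intro e he
      rw [← stratEnergy_apply_ne_top_iff, hleft] at he
      rcases mem_gadget_E_left.1 (σ'.2 _ (left_mem_gadget_VA e)) with h' | h'
      · rw [h'] at he
        exact goR e he
      · rwa [h'] at he
    have hv := hσ' (bob S)
    rcases v' with x | e | e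
    · rw [← stratEnergy_apply_ne_top_iff, hinl] at hv
      exact goL _ hv
    · exact goL e hv
    · exact goR e hv
  replace hinl := hinl Set.univ
  replace hleft := hleft Set.univ
  replace hright := hright Set.univ
  simp only [Set.mem_univ, if_true] at hright
  generalize (gadget G s).play σ' (bob Set.univ) = g at hinl hleft hright hstart
  have hgood : ∀ x, g (Sum.inr (Sum.inl ⟨(x, f x), hf x⟩)) ≠ Sum.inl s →
      g^[3] (Sum.inl x) = Sum.inl (f x) ∧
        prefixWeight (gadgetW G w s) g (Sum.inl x) 3 = w x (f x) := by
    intro x hx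
    rw [hleft] at hx
    have h' := (mem_gadget_E_left.1 (σ'.2 _ (left_mem_gadget_VA _))).resolve_right hx
    rw [← hleft] at h'
    constructor
    · simp [hinl, h', hright]
    · simp [prefixWeight, Finset.sum_range_succ, hinl, h', hright, gadgetW]
  have hbad : ∀ x, g (Sum.inr (Sum.inl ⟨(x, f x), hf x⟩)) = Sum.inl s →
      g^[2] (Sum.inl x) = Sum.inl s ∧ prefixWeight (gadgetW G w s) g (Sum.inl x) 2 =
        w x (f x) - Fintype.card V * G.maxAbsW w := by
    intro x hx
    constructor
    · simp [hinl, hx]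
    · simp [prefixWeight, Finset.sum_range_succ, hinl, hx, gadgetW, sub_eq_add_neg]
  by_cases hk : ∃ k, k < Fintype.card V ∧
      g (Sum.inr (Sum.inl ⟨(f^[k] s, f (f^[k] s)), hf _⟩)) = Sum.inl s
  · have hmin := fun i => Nat.find_min hk (m := i)
    obtain ⟨hkn, hks⟩ := Nat.find_spec hk
    generalize Nat.find hk = k at hmin hkn hks
    obtain ⟨h₁, h₂⟩ := prefixWeight_simulation (w := w) (w' := gadgetW G w s) (f := f) (g := g)
      Sum.inl 3 (s := s) (k := k) fun i hi =>
        hgood _ fun hi' => hmin i hi ⟨by omega, hi'⟩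
    obtain ⟨h₃, h₄⟩ := hbad _ hks
    have hper : g^[3 * k + 2] (Sum.inl s) = Sum.inl s := by
      rw [add_comm, Function.iterate_add_apply, h₁, h₃]
    have hnn := prefixWeight_nonneg_of_stratEnergy_ne_top hper hstart
    rw [prefixWeight_add, h₁, h₂, h₄] at hnn
    refine stratEnergy_ne_top_of_heavy_prefix hf hkn ?_
    rw [prefixWeight_add, prefixWeight_one]
    linarith
  · push Not at hk
    have hall : ∀ i, g (Sum.inr (Sum.inl ⟨(f^[i] s, f (f^[i] s)), hf _⟩)) ≠ Sum.inl s := by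
      intro i
      obtain ⟨j, hj, hji⟩ := exists_iterate_eq_of_lt_card f s i
      have := hk j hj
      simpa only [hji] using this
    rw [stratEnergy_ne_top_iff] at hstart ⊢
    obtain ⟨C, hC⟩ := hstart
    refine ⟨C, fun i => ?_⟩
    rw [← (prefixWeight_simulation (w := w) (w' := gadgetW G w s) (f := f) (g := g)
      Sum.inl 3 (s := s) (k := i) fun i _ => hgood _ (hall i)).2]
    exact hC _

theorem aliceWins_gadget (h : G.AliceWins w s) (v' : GadgetV G) :
    (gadget G s).AliceWins (gadgetW G w s) v' := by
  classical
  obtain ⟨σ, hs⟩ := (aliceWins_iff _ _ _).1 h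
  let A : Set V := {x | ∀ τ, stratEnergy w (G.play σ τ) x ≠ ⊤}
  let safe : EdgeSub G → Prop := fun e => e.1.1 ∈ A ∧ (e.1.1 ∈ G.VA → e.1.2 = σ.1 e.1.1)
  have hsafe : ∀ e, safe e → e.1.2 ∈ A := fun e he =>
    stratEnergy_ne_top_of_consistent e.2 he.2 he.1
  let σ' : (gadget G s).AliceStrategy :=
    ⟨fun a => match a with
      | Sum.inl x => if h : (x, σ.1 x) ∈ G.E then Sum.inr (Sum.inl ⟨_, h⟩) else Sum.inl s
      | Sum.inr (Sum.inl e) => if safe e then Sum.inr (Sum.inr e) else Sum.inl s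
      | Sum.inr (Sum.inr _) => Sum.inl s, by
      rintro (x | e | e) hu
      · have hx := σ.2 x (inl_mem_gadget_VA.1 hu)
        exact mem_gadget_E_inl.2 ⟨_, hx, dif_pos hx⟩
      · refine mem_gadget_E_left.2 ?_
        dsimp only
        split_ifs <;> simp
      · exact absurd hu (right_notMem_gadget_VA e)⟩
  refine (aliceWins_iff _ _ _).2 ⟨σ', fun τ' => ?_⟩
  have hex : ∀ x, ∃ (y : V) (h : (x, y) ∈ G.E),
      (gadget G s).play σ' τ' (Sum.inl x) = Sum.inr (Sum.inl ⟨(x, y), h⟩) := fun x =>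
    mem_gadget_E_inl.1 (play_mem _ _ _ _)
  choose f hf hinl using hex
  have hfA : ∀ x ∈ G.VA, f x = σ.1 x := by
    intro x hx
    have h₁ := hinl x
    have hxE := σ.2 x hx
    have h₂ : (gadget G s).play σ' τ' (Sum.inl x) =
        Sum.inr (Sum.inl ⟨(x, σ.1 x), hxE⟩) :=
      (if_pos (inl_mem_gadget_VA.2 hx)).trans (dif_pos hxE)
    rw [h₁] at h₂
    simpa using h₂
  have hplay : G.play σ ⟨f, fun x _ => hf x⟩ = f := by
    funext x
    unfold play
    split_ifs with hx
    · exact (hfA x hx).symm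
    · rfl
  have hfin : ∀ x ∈ A, stratEnergy w f x ≠ ⊤ := fun x hx => by
    have := hx ⟨f, fun x _ => hf x⟩
    rwa [hplay] at this
  have hleft : ∀ e, (gadget G s).play σ' τ' (Sum.inr (Sum.inl e)) =
      if safe e then Sum.inr (Sum.inr e) else Sum.inl s := fun e =>
    if_pos (left_mem_gadget_VA e)
  have hright : ∀ e, (gadget G s).play σ' τ' (Sum.inr (Sum.inr e)) = Sum.inl e.1.2 ∨
      (gadget G s).play σ' τ' (Sum.inr (Sum.inr e)) = Sum.inl s := fun e =>
    mem_gadget_E_right.1 (play_mem _ _ _ _)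
  generalize (gadget G s).play σ' τ' = g at hinl hleft hright
  have hsafe_f : ∀ x ∈ A, safe ⟨(x, f x), hf x⟩ := fun x hx => ⟨hx, hfA x⟩
  have hA : ∀ x ∈ A, ∀ i, f^[i] x ∈ A := by
    intro x hx i
    induction i with
    | zero => exact hx
    | succ i ih =>
      rw [Function.iterate_succ_apply']
      exact hsafe ⟨(f^[i] x, f (f^[i] x)), hf _⟩ (hsafe_f _ ih)
  have hgood : ∀ x ∈ A, g (Sum.inr (Sum.inr ⟨(x, f x), hf x⟩)) = Sum.inl (f x) →
      g^[3] (Sum.inl x) = Sum.inl (f x) ∧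
        prefixWeight (gadgetW G w s) g (Sum.inl x) 3 = w x (f x) := by
    intro x hx hg
    constructor
    · simp [hinl, hleft, hsafe_f x hx, hg]
    · simp [prefixWeight, Finset.sum_range_succ, hinl, hleft, hsafe_f x hx, hg, gadgetW]
  have hbad : ∀ x ∈ A, g (Sum.inr (Sum.inr ⟨(x, f x), hf x⟩)) ≠ Sum.inl (f x) →
      g^[3] (Sum.inl x) = Sum.inl s ∧ prefixWeight (gadgetW G w s) g (Sum.inl x) 3 =
        w x (f x) + Fintype.card V * G.maxAbsW w := by
    intro x hx hg
    have hg' := (hright _).resolve_left hg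
    have hne : s ≠ f x := by
      rintro heq
      exact hg (by rw [hg', ← heq])
    constructor
    · simp [hinl, hleft, hsafe_f x hx, hg']
    · simp [prefixWeight, Finset.sum_range_succ, hinl, hleft, hsafe_f x hx, hg', gadgetW, hne]
  have hforever : ∀ x ∈ A,
      (∀ i, g (Sum.inr (Sum.inr ⟨(f^[i] x, f (f^[i] x)), hf _⟩)) = Sum.inl (f (f^[i] x))) →
      stratEnergy (gadgetW G w s) g (Sum.inl x) ≠ ⊤ := by
    intro x hx hi
    have hsim := fun y (hy : ∃ i, f^[i] x = y) k =>
      prefixWeight_simulation (w := w) (w' := gadgetW G w s) (f := f) (g := g)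
        Sum.inl 3 (s := y) (k := k) fun j _ => by
          obtain ⟨i, rfl⟩ := hy
          rw [← Function.iterate_add_apply f j i x]
          exact hgood _ (hA x hx _) (hi _)
    obtain ⟨a, b, hab, -, heq⟩ := exists_lt_iterate_eq f x
    have hper : f^[b - a] (f^[a] x) = f^[a] x := by
      rw [← Function.iterate_add_apply, Nat.sub_add_cancel hab.le, heq]
    have hnn := prefixWeight_nonneg_of_stratEnergy_ne_top hper (hfin _ (hA x hx a))
    obtain ⟨h₁, h₂⟩ := hsim _ ⟨a, rfl⟩ (b - a)
    rw [← stratEnergy_iterate_ne_top_iff _ _ _ (3 * a), (hsim x ⟨0, rfl⟩ a).1]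
    refine stratEnergy_ne_top_of_periodic (L := 3 * (b - a)) (by omega) ?_ ?_
    · rw [h₁, hper]
    · rwa [h₂]
  have hreturn : ∀ x ∈ A,
      (∃ k, g (Sum.inr (Sum.inr ⟨(f^[k] x, f (f^[k] x)), hf _⟩)) ≠ Sum.inl (f (f^[k] x))) →
      ∃ k < Fintype.card V, g^[3 * k + 3] (Sum.inl x) = Sum.inl s ∧
        prefixWeight (gadgetW G w s) g (Sum.inl x) (3 * k + 3) =
          prefixWeight w f x (k + 1) + Fintype.card V * G.maxAbsW w := by
    intro x hx hk
    have hmin := fun i => Nat.find_min hk (m := i)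
    have hks := Nat.find_spec hk
    generalize Nat.find hk = k at hmin hks
    obtain ⟨h₁, h₂⟩ := prefixWeight_simulation (w := w) (w' := gadgetW G w s) (f := f) (g := g)
      Sum.inl 3 (s := x) (k := k) fun i hi => hgood _ (hA x hx i) (not_not.1 (hmin i hi))
    obtain ⟨h₃, h₄⟩ := hbad _ (hA x hx k) hks
    refine ⟨k, ?_, ?_, ?_⟩
    · by_contra! hkn
      obtain ⟨j, hj, hjk⟩ := exists_iterate_eq_of_lt_card f x k
      refine hmin j (by omega) ?_
      simpa only [hjk] using hks
    · rw [add_comm, Function.iterate_add_apply, h₁, h₃]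
    · rw [prefixWeight_add, h₁, h₂, h₄, prefixWeight_add, prefixWeight_one]
      ring
  have hstart : stratEnergy (gadgetW G w s) g (Sum.inl s) ≠ ⊤ := by
    by_cases hk : ∃ k, g (Sum.inr (Sum.inr ⟨(f^[k] s, f (f^[k] s)), hf _⟩)) ≠
        Sum.inl (f (f^[k] s))
    · obtain ⟨k, hkn, h₁, h₂⟩ := hreturn s hs hk
      refine stratEnergy_ne_top_of_periodic (L := 3 * k + 3) (by omega) h₁ ?_
      have hle := neg_le_of_abs_le (abs_prefixWeight_le (w := w) hf s (k + 1))
      have hkn' : ((k + 1 : ℕ) : ℤ) ≤ Fintype.card V := by exact_mod_cast hkn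
      rw [h₂]
      nlinarith [Int.natCast_nonneg (G.maxAbsW w)]
    · push Not at hk
      exact hforever s hs hk
  have goA : ∀ x ∈ A, stratEnergy (gadgetW G w s) g (Sum.inl x) ≠ ⊤ := by
    intro x hx
    by_cases hk : ∃ k, g (Sum.inr (Sum.inr ⟨(f^[k] x, f (f^[k] x)), hf _⟩)) ≠
        Sum.inl (f (f^[k] x))
    · obtain ⟨k, -, h₁, -⟩ := hreturn x hx hk
      rwa [← stratEnergy_iterate_ne_top_iff _ _ _ (3 * k + 3), h₁]
    · push Not at hk
      exact hforever x hx hk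
  have goL : ∀ e, stratEnergy (gadgetW G w s) g (Sum.inr (Sum.inl e)) ≠ ⊤ := by
    intro e
    rw [← stratEnergy_apply_ne_top_iff, hleft]
    split_ifs with he
    · rw [← stratEnergy_apply_ne_top_iff]
      rcases hright e with h' | h' <;> rw [h']
      · exact goA _ (hsafe e he)
      · exact hstart
    · exact hstart
  have goI : ∀ x, stratEnergy (gadgetW G w s) g (Sum.inl x) ≠ ⊤ := by
    intro x
    rw [← stratEnergy_apply_ne_top_iff, hinl]
    exact goL _
  rcases v' with x | e | e
  · exact goI x
  · exact goL e
  · rw [← stratEnergy_apply_ne_top_iff]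
    rcases hright e with h' | h' <;> rw [h'] <;> exact goI _

end Gadget

/-- In the gadget graph `(G',w')` obtained from `(G,w)` and the node `s`, one player
wins at every node: if Alice wins at `s` in `(G,w)` then Alice wins at every node of
`(G',w')`, and if Bob wins at `s` in `(G,w)` then Bob wins at every node of
`(G',w')`. -/
theorem gadget_one_player_wins_everywhere (G : GameGraph V) (w : V → V → ℤ) (s : V) :
    (G.AliceWins w s →
      ∀ v' : GadgetV G, (gadget G s).AliceWins (gadgetW G w s) v') ∧
    (¬ G.AliceWins w s →
      ∀ v' : GadgetV G, ¬ (gadget G s).AliceWins (gadgetW G w s) v') := by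
  constructor
  · intro h v'
    exact aliceWins_gadget h v'
  · intro h v' h'
    exact h (aliceWins_of_aliceWins_gadget h')

end GameGraph
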